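/- Let $f\in L_p(\mathbb{T})$, $1\le p<\infty$, $r,s\in\mathbb{N}$ with $s\le 2r$, and $n\in\mathbb{N}$, and let $X_n$ be nodes satisfying the mesh condition with parameter $\gamma\in(0,1]$. Then there exist positive constants $c,C$ independent of $f$ and $n$ such that $c\big(\|f_{\gamma/n,\,r}-f\|_{\ell_p(X_n)}+\omega_s(f,1/n)_p\big)\le\mathcal{K}_s(f,X_n)_p\le C\big(\|f_{\gamma/n,\,r}-f\|_{\ell_p(X_n)}+\omega_s(f,1/n)_p\big)$. -/

import Mathlib

open MeasureTheory Filter Finset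

noncomputable def LpNorm (p : ℝ) (f : ℝ → ℝ) : ℝ :=
  (∫ x in (0:ℝ)..1, |f x| ^ p) ^ (1 / p)

def MemLpT (p : ℝ) (f : ℝ → ℝ) : Prop :=
  Function.Periodic f 1 ∧ Measurable f ∧
    IntervalIntegrable (fun x => |f x| ^ p) MeasureTheory.volume 0 1

noncomputable def Delta (r : ℕ) (h : ℝ) (f : ℝ → ℝ) (x : ℝ) : ℝ :=
  ∑ ν ∈ Finset.range (r + 1), ((-1 : ℝ) ^ ν * (r.choose ν : ℝ)) * f (x + ((r : ℝ) - (ν : ℝ)) * h)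

noncomputable def omegaMod (r : ℕ) (p : ℝ) (f : ℝ → ℝ) (δ : ℝ) : ℝ :=
  sSup {y | ∃ h : ℝ, 0 < h ∧ h < δ ∧ y = LpNorm p (Delta r h f)}

noncomputable def steklov (r : ℕ) (δ : ℝ) (f : ℝ → ℝ) (x : ℝ) : ℝ :=
  (-1 : ℝ) ^ (r + 1) * (((2 * r).choose r : ℝ))⁻¹ * (2 / δ) *
    ∫ t in (-(δ / 2))..(δ / 2),
      ∑ ν ∈ Finset.range r,
        (-1 : ℝ) ^ ν * (((2 * r).choose ν : ℝ)) * f (x + (((r : ℝ) - (ν : ℝ)) / (r : ℝ)) * t)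

noncomputable def ellp (p : ℝ) (n : ℕ) (x : ℕ → ℝ) (f : ℝ → ℝ) : ℝ :=
  ((1 / (n : ℝ)) * ∑ k ∈ Finset.range n, |f (x k)| ^ p) ^ (1 / p)

def SobolevW (s : ℕ) (g : ℝ → ℝ) : Prop :=
  Function.Periodic g 1 ∧ ContDiff ℝ (s : ℕ∞) g

noncomputable def localMod (r : ℕ) (f : ℝ → ℝ) (x δ : ℝ) : ℝ :=
  sSup {y | ∃ t h : ℝ, t ∈ Set.Icc (x - r * δ / 2) (x + r * δ / 2) ∧
    (t + r * h) ∈ Set.Icc (x - r * δ / 2) (x + r * δ / 2) ∧ y = |Delta r h f t|}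

noncomputable def tauMod (r : ℕ) (p : ℝ) (f : ℝ → ℝ) (δ : ℝ) : ℝ :=
  (∫ x in (0:ℝ)..1, localMod r f x δ ^ p) ^ (1 / p)

def IsTrigPoly (n : ℕ) (T : ℝ → ℝ) : Prop :=
  ∃ c : ℤ → ℂ, ∀ x : ℝ, (T x : ℂ) =
    ∑ ℓ ∈ Finset.Icc (-(n : ℤ)) (n : ℤ),
      c ℓ * Complex.exp (2 * Real.pi * Complex.I * (ℓ : ℂ) * (x : ℂ))

noncomputable def tildeE (n : ℕ) (p : ℝ) (f : ℝ → ℝ) : ℝ :=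
  sInf {y | ∃ Q q : ℝ → ℝ, IsTrigPoly n Q ∧ IsTrigPoly n q ∧
    (∀ x, q x ≤ f x ∧ f x ≤ Q x) ∧ y = LpNorm p (fun x => Q x - q x)}

noncomputable def dirichlet (n : ℕ) (x : ℝ) : ℝ :=
  ∑ ℓ ∈ Finset.Icc (-(n : ℤ)) (n : ℤ), Real.cos (2 * Real.pi * (ℓ : ℝ) * x)

noncomputable def lagrange (n : ℕ) (f : ℝ → ℝ) (x : ℝ) : ℝ :=
  (1 / (2 * (n : ℝ) + 1)) * ∑ k ∈ Finset.range (2 * n + 1),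
    f ((k : ℝ) / (2 * (n : ℝ) + 1)) * dirichlet n (x - (k : ℝ) / (2 * (n : ℝ) + 1))

def NodesOK (γ : ℝ) (X : ℕ → ℕ → ℝ) : Prop :=
  ∀ n : ℕ, 1 ≤ n →
    (0 ≤ X n 0) ∧ (∀ k, k + 1 < n → X n k < X n (k + 1)) ∧ (X n (n - 1) < 1) ∧
    (∀ k, k + 1 < n → γ / (n : ℝ) ≤ X n (k + 1) - X n k) ∧
    (γ / (n : ℝ) ≤ 1 + X n 0 - X n (n - 1))

def NodesOrd (X : ℕ → ℕ → ℝ) : Prop :=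
  ∀ n : ℕ, 1 ≤ n →
    (0 ≤ X n 0) ∧ (∀ k, k + 1 < n → X n k < X n (k + 1)) ∧ (X n (n - 1) < 1)

def SamplingForm (p : ℝ) (X : ℕ → ℕ → ℝ) (φ : ℕ → ℕ → ℝ → ℝ)
    (G : ℕ → (ℝ → ℝ) → ℝ → ℝ) : Prop :=
  (∀ n k, MemLpT p (φ n k)) ∧
  ∀ (n : ℕ) (f : ℝ → ℝ) (x : ℝ), G n f x = ∑ k ∈ Finset.range n, f (X n k) * φ n k x

def CondC1 (p K1 : ℝ) (X : ℕ → ℕ → ℝ) (G : ℕ → (ℝ → ℝ) → ℝ → ℝ) : Prop :=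
  ∀ f : ℝ → ℝ, MemLpT p f → ∀ n : ℕ, 1 ≤ n → LpNorm p (G n f) ≤ K1 * ellp p n (X n) f

def CondC1' (p K2 : ℝ) (X : ℕ → ℕ → ℝ) (G : ℕ → (ℝ → ℝ) → ℝ → ℝ) : Prop :=
  ∀ f : ℝ → ℝ, MemLpT p f → ∀ n : ℕ, 1 ≤ n → K2 * ellp p n (X n) f ≤ LpNorm p (G n f)

def CondC2' (p K3 : ℝ) (s : ℕ) (G : ℕ → (ℝ → ℝ) → ℝ → ℝ) : Prop :=
  ∀ g : ℝ → ℝ, SobolevW s g → ∀ n : ℕ, 1 ≤ n →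
    LpNorm p (fun x => g x - G n g x) ≤ K3 / (n : ℝ) ^ s * LpNorm p (iteratedDeriv s g)

def CondC3 (p K5 : ℝ) (s : ℕ) (G : ℕ → (ℝ → ℝ) → ℝ → ℝ) : Prop :=
  ∀ f : ℝ → ℝ, MemLpT p f → ∀ n : ℕ, 1 ≤ n →
    SobolevW s (G n f) ∧
    (1 / (n : ℝ) ^ s) * LpNorm p (iteratedDeriv s (G n f)) ≤
      K5 * omegaMod s p (G n f) (1 / (n : ℝ))

noncomputable def Gprev (G : ℕ → (ℝ → ℝ) → ℝ → ℝ) (f : ℝ → ℝ) (ν : ℕ) : ℝ → ℝ :=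
  if ν = 0 then fun _ => 0 else G (2 ^ (ν - 1)) f

def CondC4 (p K4 : ℝ) (s : ℕ) (G : ℕ → (ℝ → ℝ) → ℝ → ℝ) (f : ℝ → ℝ) : Prop :=
  ∀ ν : ℕ,
    SobolevW s (fun x => G (2 ^ ν) f x - Gprev G f ν x) ∧
    LpNorm p (iteratedDeriv s (fun x => G (2 ^ ν) f x - Gprev G f ν x)) ≤
      K4 * 2 ^ (s * ν) * LpNorm p (fun x => G (2 ^ ν) f x - Gprev G f ν x)

noncomputable def Kfun (s : ℕ) (p : ℝ) (n : ℕ) (x : ℕ → ℝ) (f : ℝ → ℝ) : ℝ :=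
  sInf {y | ∃ g : ℝ → ℝ, SobolevW s g ∧
    y = ellp p n x (fun t => f t - g t) + LpNorm p (fun t => f t - g t) +
        (1 / (n : ℝ) ^ s) * LpNorm p (iteratedDeriv s g)}

/-- The reference probability measure on one period. -/
noncomputable def mu1 : Measure ℝ := volume.restrict (Set.Ioc (0:ℝ) 1)

instance mu1_prob : IsProbabilityMeasure mu1 := ⟨by simp [mu1]⟩

/-- Extended `L_p` norm on a period. -/
noncomputable def EN (p : ℝ) (f : ℝ → ℝ) : ENNReal := eLpNorm f (ENNReal.ofReal p) mu1

/-- Periodic, measurable, locally integrable. -/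
def Good (f : ℝ → ℝ) : Prop :=
  Function.Periodic f 1 ∧ Measurable f ∧ ∀ a b, IntervalIntegrable f volume a b

lemma ofReal_p_ne {p : ℝ} (hp : 1 ≤ p) : ENNReal.ofReal p ≠ 0 := by
  simp; linarith

lemma one_le_ofReal_p {p : ℝ} (hp : 1 ≤ p) : 1 ≤ ENNReal.ofReal p := by
  simpa using ENNReal.ofReal_le_ofReal hp

lemma integrable_pow_iff {p : ℝ} (hp : 1 ≤ p) {f : ℝ → ℝ} (hf : Measurable f) :
    IntervalIntegrable (fun x => |f x| ^ p) volume 0 1 ↔ MemLp f (ENNReal.ofReal p) mu1 := by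
  rw [intervalIntegrable_iff_integrableOn_Ioc_of_le zero_le_one,
    ← integrable_norm_rpow_iff hf.aestronglyMeasurable (ofReal_p_ne hp) ENNReal.ofReal_ne_top,
    ENNReal.toReal_ofReal (by linarith)]
  rfl

lemma LpNorm_eq {p : ℝ} (hp : 1 ≤ p) {f : ℝ → ℝ} (hf : Measurable f) :
    LpNorm p f = (EN p f).toReal := by
  have hp0 : 0 < p := by linarith
  have key : (∫ x in (0:ℝ)..1, |f x| ^ p) = ∫ x, ‖f x‖ ^ p ∂mu1 := by
    rw [intervalIntegral.integral_of_le zero_le_one]; rfl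
  unfold LpNorm EN
  rw [key]
  by_cases hm : MemLp f (ENNReal.ofReal p) mu1
  · rw [hm.eLpNorm_eq_integral_rpow_norm (ofReal_p_ne hp) ENNReal.ofReal_ne_top,
      ENNReal.toReal_ofReal hp0.le, ENNReal.toReal_ofReal, one_div]
    positivity
  · have h1 : eLpNorm f (ENNReal.ofReal p) mu1 = ⊤ := by
      by_contra h
      exact hm ⟨hf.aestronglyMeasurable, lt_top_iff_ne_top.2 h⟩
    rw [h1, integral_undef]
    · simp [Real.zero_rpow, hp0.ne']
    · intro hi
      apply hm
      rw [← integrable_norm_rpow_iff hf.aestronglyMeasurable (ofReal_p_ne hp)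
        ENNReal.ofReal_ne_top, ENNReal.toReal_ofReal hp0.le]
      exact hi

lemma LpNorm_nonneg (p : ℝ) (f : ℝ → ℝ) : 0 ≤ LpNorm p f := by
  unfold LpNorm
  apply Real.rpow_nonneg
  apply intervalIntegral.integral_nonneg zero_le_one
  intros; positivity

lemma ellp_nonneg (p : ℝ) (n : ℕ) (x : ℕ → ℝ) (f : ℝ → ℝ) : 0 ≤ ellp p n x f := by
  unfold ellp; positivity

lemma good_of_memLpT {p : ℝ} (hp : 1 ≤ p) {f : ℝ → ℝ} (hf : MemLpT p f) : Good f := by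
  refine ⟨hf.1, hf.2.1, ?_⟩
  have h := (integrable_pow_iff hp hf.2.1).1 hf.2.2
  have h2 : Integrable f mu1 := h.integrable (one_le_ofReal_p hp)
  have h3 : IntervalIntegrable f volume 0 (0+1) := by
    rw [zero_add, intervalIntegrable_iff_integrableOn_Ioc_of_le zero_le_one]
    exact h2
  intro a b
  exact hf.1.intervalIntegrable one_ne_zero h3 a b

lemma EN_lt_top {p : ℝ} (hp : 1 ≤ p) {f : ℝ → ℝ} (hf : MemLpT p f) : EN p f < ⊤ :=
  ((integrable_pow_iff hp hf.2.1).1 hf.2.2).2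

lemma memLpT_of_EN {p : ℝ} (hp : 1 ≤ p) {f : ℝ → ℝ} (h1 : Function.Periodic f 1)
    (h2 : Measurable f) (h3 : EN p f < ⊤) : MemLpT p f :=
  ⟨h1, h2, (integrable_pow_iff hp h2).2 ⟨h2.aestronglyMeasurable, h3⟩⟩

lemma good_of_cont {f : ℝ → ℝ} (h1 : Function.Periodic f 1) (h2 : Continuous f) : Good f :=
  ⟨h1, h2.measurable, fun a b => h2.intervalIntegrable a b⟩

lemma memLpT_of_cont {p : ℝ} (hp : 1 ≤ p) {f : ℝ → ℝ} (h1 : Function.Periodic f 1)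
    (h2 : Continuous f) : MemLpT p f := by
  refine ⟨h1, h2.measurable, ?_⟩
  apply Continuous.intervalIntegrable
  exact h2.abs.rpow_const (fun _ => Or.inr (by linarith))

lemma EN_translate {p : ℝ} (hp : 1 ≤ p) {f : ℝ → ℝ} (h1 : Function.Periodic f 1) (a : ℝ) :
    EN p (fun x => f (x + a)) = EN p f := by
  unfold EN
  rw [eLpNorm_eq_lintegral_rpow_enorm_toReal (ofReal_p_ne hp) ENNReal.ofReal_ne_top,
    eLpNorm_eq_lintegral_rpow_enorm_toReal (ofReal_p_ne hp) ENNReal.ofReal_ne_top]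
  congr 1
  set G : ℝ → ENNReal := fun x => ‖f x‖ₑ ^ (ENNReal.ofReal p).toReal with hG
  have hGp : ∀ x, G (x + 1) = G x := fun x => by simp [hG, h1 x]
  have e1 : ∫⁻ x, G (x + a) ∂mu1 = ∫⁻ x in Set.Ioc a (a + 1), G x := by
    have hmp := (measurePreserving_add_right (volume : Measure ℝ) a)
    have := hmp.setLIntegral_comp_preimage_emb (measurableEmbedding_addRight a) G
      (Set.Ioc a (a+1))
    rw [← this]
    unfold mu1
    congr 2
    ext x; simp [add_comm]
  have e2 : ∫⁻ x in Set.Ioc a (a + 1), G x = ∫⁻ x in Set.Ioc 0 (0 + 1), G x := by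
    have hper : Function.Periodic G 1 := hGp
    exact IsAddFundamentalDomain.setLIntegral_eq
      (isAddFundamentalDomain_Ioc zero_lt_one a volume)
      (isAddFundamentalDomain_Ioc zero_lt_one 0 volume) G hper.map_vadd_zmultiples
  change ∫⁻ x, G (x + a) ∂mu1 = ∫⁻ x, G x ∂mu1
  rw [e1, e2, zero_add]; rfl

/-- Minkowski-type bound for averages. -/
lemma EN_avg_le {p : ℝ} (hp : 1 ≤ p) {Φ : ℝ → ℝ → ℝ} (hm : Measurable (Function.uncurry Φ))
    {B : ENNReal} (hB : ∀ u ∈ Set.Ioc (0:ℝ) 1, EN p (fun x => Φ x u) ≤ B) :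
    EN p (fun x => ∫ u, Φ x u ∂mu1) ≤ B := by
  have hp0 : 0 < p := by linarith
  have form : ∀ f : ℝ → ℝ, EN p f = (∫⁻ x, ‖f x‖ₑ ^ p ∂mu1) ^ (1 / p) := by
    intro f
    unfold EN
    rw [eLpNorm_eq_lintegral_rpow_enorm_toReal (ofReal_p_ne hp) ENNReal.ofReal_ne_top,
      ENNReal.toReal_ofReal hp0.le]
  have toB : ∀ f : ℝ → ℝ, EN p f ≤ B ↔ ∫⁻ x, ‖f x‖ₑ ^ p ∂mu1 ≤ B ^ p := by
    intro f
    rw [form, one_div, ENNReal.rpow_inv_le_iff hp0]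
  rw [toB]
  have J : ∀ x, ‖∫ u, Φ x u ∂mu1‖ₑ ^ p ≤ ∫⁻ u, ‖Φ x u‖ₑ ^ p ∂mu1 := by
    intro x
    have hmx : Measurable (Φ x) := hm.comp measurable_prodMk_left
    have h1 : ‖∫ u, Φ x u ∂mu1‖ₑ ≤ EN p (Φ x) := by
      refine (enorm_integral_le_lintegral_enorm _).trans ?_
      rw [← eLpNorm_one_eq_lintegral_enorm]
      exact eLpNorm_le_eLpNorm_of_exponent_le (one_le_ofReal_p hp) hmx.aestronglyMeasurable
    rw [form, one_div, ENNReal.le_rpow_inv_iff hp0] at h1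
    exact h1
  calc ∫⁻ x, ‖∫ u, Φ x u ∂mu1‖ₑ ^ p ∂mu1
      ≤ ∫⁻ x, ∫⁻ u, ‖Φ x u‖ₑ ^ p ∂mu1 ∂mu1 := lintegral_mono J
    _ = ∫⁻ u, ∫⁻ x, ‖Φ x u‖ₑ ^ p ∂mu1 ∂mu1 := by
        apply lintegral_lintegral_swap
        exact (hm.enorm.pow_const p).aemeasurable
    _ ≤ ∫⁻ u, B ^ p ∂mu1 := by
        apply lintegral_mono_ae
        have : ∀ᵐ u ∂mu1, u ∈ Set.Ioc (0:ℝ) 1 := ae_restrict_mem measurableSet_Ioc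
        filter_upwards [this] with u hu
        exact (toB _).1 (hB u hu)
    _ = B ^ p := by simp

lemma EN_const_mul {p : ℝ} (c : ℝ) (f : ℝ → ℝ) :
    EN p (fun x => c * f x) ≤ ENNReal.ofReal |c| * EN p f := by
  have := eLpNorm_const_smul_le (c := c) (f := f) (p := ENNReal.ofReal p) (μ := mu1)
  rw [← Real.enorm_eq_ofReal_abs]
  exact this

lemma EN_sum_le {p : ℝ} (hp : 1 ≤ p) {ι : Type*} (s : Finset ι) (c : ι → ℝ) (f : ι → ℝ → ℝ)
    (hf : ∀ i ∈ s, Measurable (f i)) {B : ENNReal} (hB : ∀ i ∈ s, EN p (f i) ≤ B) :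
    EN p (fun x => ∑ i ∈ s, c i * f i x) ≤ ENNReal.ofReal (∑ i ∈ s, |c i|) * B := by
  have h1 : (fun x => ∑ i ∈ s, c i * f i x) = ∑ i ∈ s, (fun x => c i * f i x) := by
    ext x; simp
  rw [h1]
  refine (eLpNorm_sum_le (fun i hi => ((hf i hi).const_mul (c i)).aestronglyMeasurable)
    (one_le_ofReal_p hp)).trans ?_
  rw [ENNReal.ofReal_sum_of_nonneg (fun i _ => abs_nonneg _), Finset.sum_mul]
  apply Finset.sum_le_sum
  intro i hi
  refine (EN_const_mul (p := p) (c i) (f i)).trans ?_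
  gcongr
  exact hB i hi

lemma Delta_zero_step (s : ℕ) (hs : 1 ≤ s) (f : ℝ → ℝ) (x : ℝ) : Delta s 0 f x = 0 := by
  unfold Delta
  simp only [mul_zero, add_zero]
  rw [← Finset.sum_mul]
  have := Int.alternating_sum_range_choose (n := s)
  rw [if_neg (by omega)] at this
  have h2 : (∑ i ∈ Finset.range (s+1), (-1:ℝ)^i * (s.choose i : ℝ)) = 0 := by
    exact_mod_cast this
  rw [h2, zero_mul]

lemma Delta_eq_fwd (m : ℕ) (h : ℝ) (f : ℝ → ℝ) : Delta m h f = (fwdDiff h)^[m] f := by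
  ext x
  rw [fwdDiff_iter_eq_sum_shift]
  unfold Delta
  rw [← Finset.sum_range_reflect]
  apply Finset.sum_congr rfl
  intro k hk
  have hk' : k ≤ m := by simpa [Nat.lt_succ_iff] using hk
  have e : m + 1 - 1 - k = m - k := by omega
  rw [e, Nat.choose_symm hk', Nat.cast_sub hk']
  simp only [zsmul_eq_mul, nsmul_eq_mul]
  push_cast
  congr 3; ring

lemma Delta_succ (m : ℕ) (h : ℝ) (f : ℝ → ℝ) (x : ℝ) :
    Delta (m+1) h f x = Delta m h f (x + h) - Delta m h f x := by
  rw [Delta_eq_fwd, Delta_eq_fwd, Function.iterate_succ_apply']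
  rfl

lemma Delta_meas (m : ℕ) (h : ℝ) {f : ℝ → ℝ} (hf : Measurable f) : Measurable (Delta m h f) := by
  unfold Delta
  fun_prop

lemma choose_abs_sum (m : ℕ) :
    ∑ ν ∈ Finset.range (m+1), |(-1:ℝ)^ν * (m.choose ν : ℝ)| = 2 ^ m := by
  have := Nat.sum_range_choose m
  have h2 : ∑ ν ∈ Finset.range (m+1), (m.choose ν : ℝ) = 2 ^ m := by exact_mod_cast this
  rw [← h2]
  apply Finset.sum_congr rfl
  intro i _
  simp [abs_mul]

lemma EN_Delta_le {p : ℝ} (hp : 1 ≤ p) (m : ℕ) (h : ℝ) {f : ℝ → ℝ}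
    (h1 : Function.Periodic f 1) (h2 : Measurable f) :
    EN p (Delta m h f) ≤ ENNReal.ofReal (2 ^ m) * EN p f := by
  rw [← choose_abs_sum]
  apply EN_sum_le hp (Finset.range (m+1)) _ (fun ν x => f (x + ((m:ℝ) - ν) * h))
  · intro i _; fun_prop
  · intro i _; rw [EN_translate hp h1]

/-- Average of `f` over `[x, x+a]`. -/
noncomputable def Av (a : ℝ) (f : ℝ → ℝ) (x : ℝ) : ℝ := ∫ u, f (x + a * u) ∂mu1

lemma Av_eq_interval (a : ℝ) (f : ℝ → ℝ) (x : ℝ) :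
    Av a f x = ∫ u in (0:ℝ)..1, f (x + a * u) := by
  rw [intervalIntegral.integral_of_le zero_le_one]; rfl

lemma Av_eq {a : ℝ} (ha : a ≠ 0) (f : ℝ → ℝ) (x : ℝ) :
    Av a f x = a⁻¹ * ∫ y in x..(x + a), f y := by
  rw [Av_eq_interval, intervalIntegral.integral_comp_add_mul f ha]
  simp

lemma Good.integrable {f : ℝ → ℝ} (hf : Good f) (x a : ℝ) :
    Integrable (fun u => f (x + a * u)) mu1 := by
  rcases eq_or_ne a 0 with rfl | ha
  · simp
  have h0 : IntervalIntegrable f volume (a * 0 + x) (a * 1 + x) := hf.2.2 _ _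
  have h1 := h0.comp_add_right x
  have h2 := h1.comp_mul_left (c := a)
  have h3 : IntervalIntegrable (fun u => f (x + a * u)) volume 0 1 := by
    convert h2 using 1
    · ext u; rw [add_comm]
    · field_simp; simp
    · field_simp; simp
  rwa [intervalIntegrable_iff_integrableOn_Ioc_of_le zero_le_one] at h3

lemma Good.cont_Av {f : ℝ → ℝ} (hf : Good f) {a : ℝ} (ha : a ≠ 0) : Continuous (Av a f) := by
  have h : Av a f = fun x => a⁻¹ * ((∫ y in (0:ℝ)..(x + a), f y) - ∫ y in (0:ℝ)..x, f y) := by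
    ext x
    rw [Av_eq ha, intervalIntegral.integral_interval_sub_left (hf.2.2 _ _) (hf.2.2 _ _)]
  rw [h]
  have hc := intervalIntegral.continuous_primitive hf.2.2 0
  have hc2 : Continuous (fun x => ∫ y in (0:ℝ)..(x + a), f y) :=
    hc.comp (continuous_id.add continuous_const)
  fun_prop

lemma Av_periodic {f : ℝ → ℝ} (hf : Function.Periodic f 1) (a : ℝ) :
    Function.Periodic (Av a f) 1 := by
  intro x
  unfold Av
  congr 1; ext u
  rw [← hf (x + a * u)]; congr 1; ring

lemma Good.good_Av {f : ℝ → ℝ} (hf : Good f) {a : ℝ} (ha : a ≠ 0) : Good (Av a f) :=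
  good_of_cont (Av_periodic hf.1 a) (hf.cont_Av ha)

lemma Good.good_Av_iter {f : ℝ → ℝ} (hf : Good f) {a : ℝ} (ha : a ≠ 0) (m : ℕ) :
    Good ((Av a)^[m] f) := by
  induction m with
  | zero => exact hf
  | succ m ih => rw [Function.iterate_succ_apply']; exact ih.good_Av ha

lemma EN_Av_le {p : ℝ} (hp : 1 ≤ p) {f : ℝ → ℝ} (h1 : Function.Periodic f 1) (h2 : Measurable f)
    (a : ℝ) : EN p (Av a f) ≤ EN p f := by
  unfold Av
  apply EN_avg_le hp (Φ := fun x u => f (x + a * u))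
  · unfold Function.uncurry; fun_prop
  · intro u _; rw [EN_translate hp h1]

lemma Good.Delta {f : ℝ → ℝ} (hf : Good f) (m : ℕ) (h : ℝ) : Good (Delta m h f) := by
  refine ⟨?_, Delta_meas m h hf.2.1, ?_⟩
  · intro x
    unfold _root_.Delta
    apply Finset.sum_congr rfl
    intro i _
    rw [← hf.1 (x + _)]; congr 2; ring
  · intro a b
    unfold _root_.Delta
    have := IntervalIntegrable.sum (μ := volume) (a := a) (b := b) (Finset.range (m+1))
      (f := fun ν x => ((-1 : ℝ) ^ ν * (m.choose ν : ℝ)) * f (x + ((m : ℝ) - (ν : ℝ)) * h))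
      (fun i _ => by
        have h1 := (hf.2.2 (a + ((m : ℝ) - (i : ℝ)) * h) (b + ((m : ℝ) - (i : ℝ)) * h)).comp_add_right
          (((m : ℝ) - (i : ℝ)) * h)
        simp only [add_sub_cancel_right] at h1
        exact h1.const_mul _)
    have e : (fun x => ∑ ν ∈ Finset.range (m + 1),
        ((-1 : ℝ) ^ ν * (m.choose ν : ℝ)) * f (x + ((m : ℝ) - (ν : ℝ)) * h)) =
        ∑ ν ∈ Finset.range (m + 1), fun x =>
          ((-1 : ℝ) ^ ν * (m.choose ν : ℝ)) * f (x + ((m : ℝ) - (ν : ℝ)) * h) := by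
      ext x; simp
    change IntervalIntegrable (fun x => ∑ ν ∈ Finset.range (m + 1),
        ((-1 : ℝ) ^ ν * (m.choose ν : ℝ)) * f (x + ((m : ℝ) - (ν : ℝ)) * h)) volume a b
    rw [e]
    exact this

lemma Delta_Av {f : ℝ → ℝ} (hf : Good f) (m : ℕ) (h a : ℝ) :
    Delta m h (Av a f) = Av a (Delta m h f) := by
  ext x
  unfold Delta Av
  rw [integral_finsetSum]
  · apply Finset.sum_congr rfl
    intro i _
    rw [integral_const_mul]
    congr 2; ext u; congr 1; ring
  · intro i _
    apply Integrable.const_mul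
    have := hf.integrable (x + ((m : ℝ) - (i : ℝ)) * h) a
    convert this using 2
    congr 1; ring

/-- Difference quotient. -/
noncomputable def Bq (a : ℝ) (F : ℝ → ℝ) (x : ℝ) : ℝ := a⁻¹ * (F (x + a) - F x)

lemma hasDerivAt_Av {F : ℝ → ℝ} (hF : Continuous F) {a : ℝ} (ha : a ≠ 0) (x : ℝ) :
    HasDerivAt (Av a F) (Bq a F x) x := by
  have h : Av a F = fun x => a⁻¹ * ((∫ y in (0:ℝ)..(x + a), F y) - ∫ y in (0:ℝ)..x, F y) := by
    ext x
    rw [Av_eq ha, intervalIntegral.integral_interval_sub_left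
      (hF.intervalIntegrable _ _) (hF.intervalIntegrable _ _)]
  rw [h]
  have h1 : ∀ z, HasDerivAt (fun x => ∫ y in (0:ℝ)..x, F y) (F z) z := fun z =>
    intervalIntegral.integral_hasDerivAt_right (hF.intervalIntegrable _ _)
      (hF.stronglyMeasurableAtFilter _ _) hF.continuousAt
  have h2 := (h1 (x + a)).comp_add_const x a
  exact (h2.sub (h1 x)).const_mul _

lemma Bq_cont {F : ℝ → ℝ} (hF : Continuous F) (a : ℝ) : Continuous (Bq a F) := by
  unfold Bq; fun_prop

lemma Av_cont {F : ℝ → ℝ} (hF : Continuous F) {a : ℝ} (ha : a ≠ 0) : Continuous (Av a F) :=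
  continuous_iff_continuousAt.2 fun x => (hasDerivAt_Av hF ha x).continuousAt

lemma Av_Bq {F : ℝ → ℝ} (hF : Continuous F) (a : ℝ) : Av a (Bq a F) = Bq a (Av a F) := by
  ext x
  simp only [Av_eq_interval, Bq]
  rw [intervalIntegral.integral_const_mul, intervalIntegral.integral_sub]
  · congr 3; ext u; congr 1; ring
  · apply Continuous.intervalIntegrable; fun_prop
  · apply Continuous.intervalIntegrable; fun_prop

lemma Av_iter_Bq {F : ℝ → ℝ} (hF : Continuous F) {a : ℝ} (ha : a ≠ 0) (m : ℕ) :
    (Av a)^[m] (Bq a F) = Bq a ((Av a)^[m] F) ∧ Continuous ((Av a)^[m] F) := by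
  induction m with
  | zero => exact ⟨rfl, hF⟩
  | succ m ih =>
    simp only [Function.iterate_succ_apply']
    rw [ih.1]
    exact ⟨Av_Bq ih.2 a, Av_cont ih.2 ha⟩

lemma Av_iter_deriv {a : ℝ} (ha : a ≠ 0) (m : ℕ) : ∀ {F : ℝ → ℝ}, Continuous F →
    ContDiff ℝ m ((Av a)^[m] F) ∧ iteratedDeriv m ((Av a)^[m] F) = (Bq a)^[m] F := by
  induction m with
  | zero => intro F hF; simpa using hF
  | succ m ih =>
    intro F hF
    have hc := (Av_iter_Bq hF ha m)
    have hd : deriv ((Av a)^[m+1] F) = (Av a)^[m] (Bq a F) := by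
      ext x
      rw [Function.iterate_succ_apply', hc.1]
      exact (hasDerivAt_Av hc.2 ha x).deriv
    have hB := ih (Bq_cont hF a)
    constructor
    · push_cast
      rw [contDiff_succ_iff_deriv]
      refine ⟨?_, by simp, ?_⟩
      · intro x
        rw [Function.iterate_succ_apply']
        exact (hasDerivAt_Av hc.2 ha x).differentiableAt
      · rw [hd]; exact hB.1
    · rw [iteratedDeriv_succ', hd, hB.2, Function.iterate_succ_apply]

lemma Bq_iter (a : ℝ) (m : ℕ) (F : ℝ → ℝ) (x : ℝ) :
    (Bq a)^[m] F x = (a⁻¹) ^ m * Delta m a F x := by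
  induction m generalizing x with
  | zero => simp [Delta]
  | succ m ih =>
    rw [Function.iterate_succ_apply', Delta_succ]
    unfold Bq at ih ⊢
    rw [ih, ih]; ring

lemma Av_def (a : ℝ) (f : ℝ → ℝ) (x : ℝ) : Av a f x = ∫ u, f (x + a * u) ∂mu1 := rfl

lemma Av_zero (f : ℝ → ℝ) : Av 0 f = f := by
  ext x; simp [Av]

lemma Good.good_Av_iter' {f : ℝ → ℝ} (hf : Good f) (a : ℝ) (m : ℕ) :
    Good ((Av a)^[m] f) := by
  rcases eq_or_ne a 0 with rfl | ha
  · rw [Function.iterate_fixed (Av_zero f)]; exact hf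
  · exact hf.good_Av_iter ha m

/-- The averaged difference. -/
noncomputable def DD (s : ℕ) (h : ℝ) (f : ℝ → ℝ) (m : ℕ) (w x : ℝ) : ℝ :=
  ∑ ν ∈ Finset.range (s + 1), ((-1 : ℝ) ^ ν * (s.choose ν : ℝ)) *
    (Av (((s : ℝ) - (ν : ℝ)) * h))^[m] f (x + ((s : ℝ) - (ν : ℝ)) * w)

lemma DD_bound {p : ℝ} (hp : 1 ≤ p) {s : ℕ} (hs : 1 ≤ s) {h δ : ℝ} (hh : 0 < h) {f : ℝ → ℝ}
    (hf : Good f) {B : ENNReal} (hB : ∀ v, 0 < v → v < δ → EN p (Delta s v f) ≤ B) (m : ℕ) :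
    ∀ w, 0 ≤ w → w + m * h < δ → EN p (DD s h f m w) ≤ B := by
  induction m with
  | zero =>
    intro w hw hw2
    have e : DD s h f 0 w = Delta s w f := by
      ext x; simp [DD, Delta]
    rw [e]
    rcases hw.eq_or_lt with rfl | hw'
    · have : Delta s 0 f = fun _ => 0 := by
        ext x; exact Delta_zero_step s hs f x
      rw [this]
      simp [EN]
    · exact hB w hw' (by simpa using hw2)
  | succ m ih =>
    intro w hw hw2
    have e : DD s h f (m+1) w = fun x => ∫ u, DD s h f m (w + h * u) x ∂mu1 := by
      ext x
      unfold DD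
      rw [integral_finsetSum]
      · apply Finset.sum_congr rfl
        intro i _
        rw [integral_const_mul, Function.iterate_succ_apply']
        congr 1
        rw [Av_def]
        congr 1; ext u; ring_nf
      · intro i _
        apply Integrable.const_mul
        have := (hf.good_Av_iter' (((s : ℝ) - (i : ℝ)) * h) m).integrable
          (x + ((s : ℝ) - (i : ℝ)) * w) (((s : ℝ) - (i : ℝ)) * h)
        convert this using 2
        ring_nf
    rw [e]
    apply EN_avg_le hp (Φ := fun x u => DD s h f m (w + h * u) x)
    · unfold DD Function.uncurry
      apply Finset.measurable_sum
      intro i _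
      have := (hf.good_Av_iter' (((s : ℝ) - (i : ℝ)) * h) m).2.1
      fun_prop
    · intro u hu
      apply ih
      · have := hu.1; positivity
      · push_cast at hw2
        nlinarith [hu.2, mul_le_mul_of_nonneg_left hu.2 hh.le]

/-- The smooth approximant. -/
noncomputable def gApp (s : ℕ) (h : ℝ) (f : ℝ → ℝ) (x : ℝ) : ℝ :=
  ∑ ν ∈ Finset.range s, (-((-1:ℝ)^s) * ((-1 : ℝ) ^ ν * (s.choose ν : ℝ))) *
    (Av (((s : ℝ) - (ν : ℝ)) * h))^[s+1] f x

lemma gApp_sub (s : ℕ) (h : ℝ) (f : ℝ → ℝ) :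
    (fun x => f x - gApp s h f x) = fun x => (-1:ℝ)^s * DD s h f (s+1) 0 x := by
  ext x
  unfold gApp DD
  rw [Finset.sum_range_succ]
  simp only [sub_self, zero_mul, mul_zero, add_zero, Nat.choose_self, Nat.cast_one, mul_one]
  rw [Function.iterate_fixed (Av_zero f), mul_add, Finset.mul_sum]
  have : (-1:ℝ)^s * ((-1)^s * f x) = f x := by
    rw [← mul_assoc, ← pow_add, ← two_mul, pow_mul]; simp
  rw [this, sub_eq_add_neg, ← Finset.sum_neg_distrib, add_comm (f x)]
  congr 1
  apply Finset.sum_congr rfl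
  intro i _
  ring

lemma EN_f_sub_gApp {p : ℝ} (hp : 1 ≤ p) {s : ℕ} (hs : 1 ≤ s) {h δ : ℝ} (hh : 0 < h) {f : ℝ → ℝ}
    (hf : Good f) {B : ENNReal} (hB : ∀ v, 0 < v → v < δ → EN p (Delta s v f) ≤ B)
    (hδ : (s + 1) * h < δ) : EN p (fun x => f x - gApp s h f x) ≤ B := by
  rw [gApp_sub]
  refine (EN_const_mul _ _).trans ?_
  simp only [abs_pow, abs_neg, abs_one, one_pow, ENNReal.ofReal_one, one_mul]
  apply DD_bound hp hs hh hf hB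
  · exact le_rfl
  · push_cast; linarith

lemma gApp_smooth {s : ℕ} {h : ℝ} (hh : 0 < h) {f : ℝ → ℝ} (hf : Good f) :
    SobolevW s (gApp s h f) ∧
    iteratedDeriv s (gApp s h f) = fun x => ∑ ν ∈ Finset.range s,
      (-((-1:ℝ)^s) * ((-1 : ℝ) ^ ν * (s.choose ν : ℝ)) * ((((s : ℝ) - (ν : ℝ)) * h)⁻¹) ^ s) *
        Av (((s : ℝ) - (ν : ℝ)) * h) (Delta s (((s : ℝ) - (ν : ℝ)) * h) f) x := by
  have ha : ∀ ν ∈ Finset.range s, (((s : ℝ) - (ν : ℝ)) * h) ≠ 0 := by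
    intro ν hν
    have : (ν : ℝ) < s := by exact_mod_cast Finset.mem_range.1 hν
    have : 0 < (s : ℝ) - ν := by linarith
    positivity
  have key : ∀ ν ∈ Finset.range s, ContDiff ℝ s ((Av (((s : ℝ) - (ν : ℝ)) * h))^[s+1] f) ∧
      iteratedDeriv s ((Av (((s : ℝ) - (ν : ℝ)) * h))^[s+1] f) =
       fun x => ((((s : ℝ) - (ν : ℝ)) * h)⁻¹) ^ s *
        Av (((s : ℝ) - (ν : ℝ)) * h) (Delta s (((s : ℝ) - (ν : ℝ)) * h) f) x := by
    intro ν hν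
    have := Av_iter_deriv (ha ν hν) s (hf.cont_Av (ha ν hν))
    rw [Function.iterate_succ_apply]
    refine ⟨this.1, ?_⟩
    rw [this.2]
    ext x
    rw [Bq_iter, Delta_Av hf]
  have hcd : ∀ ν ∈ Finset.range s, ContDiff ℝ s (fun x =>
      (-((-1:ℝ)^s) * ((-1 : ℝ) ^ ν * (s.choose ν : ℝ))) *
        (Av (((s : ℝ) - (ν : ℝ)) * h))^[s+1] f x) := fun ν hν =>
    contDiff_const.mul (key ν hν).1
  refine ⟨⟨?_, ?_⟩, ?_⟩
  · intro x
    unfold gApp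
    apply Finset.sum_congr rfl
    intro i _
    rw [(hf.good_Av_iter' _ _).1 x]
  · exact ContDiff.sum hcd
  · ext x
    unfold gApp
    rw [iteratedDeriv_fun_sum (fun i hi => (hcd i hi).contDiffAt)]
    apply Finset.sum_congr rfl
    intro ν hν
    rw [iteratedDeriv_const_mul_field, (key ν hν).2]
    ring

lemma EN_gApp_deriv {p : ℝ} (hp : 1 ≤ p) {s : ℕ} {h δ : ℝ} (hh : 0 < h) {f : ℝ → ℝ}
    (hf : Good f) {B : ENNReal} (hB : ∀ v, 0 < v → v < δ → EN p (Delta s v f) ≤ B)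
    (hδ : s * h < δ) :
    EN p (iteratedDeriv s (gApp s h f)) ≤ ENNReal.ofReal (2 ^ s * (h⁻¹) ^ s) * B := by
  rw [(gApp_smooth hh hf).2]
  have hpos : ∀ ν ∈ Finset.range s, 1 ≤ (s : ℝ) - ν := by
    intro ν hν
    have : ν + 1 ≤ s := Finset.mem_range.1 hν
    have : (ν : ℝ) + 1 ≤ s := by exact_mod_cast this
    linarith
  refine (EN_sum_le hp (Finset.range s) _
    (fun ν => Av (((s : ℝ) - (ν : ℝ)) * h) (Delta s (((s : ℝ) - (ν : ℝ)) * h) f)) ?_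
    (B := B) ?_).trans ?_
  · intro ν hν
    have := hpos ν hν
    exact ((hf.Delta s _).good_Av (by positivity)).2.1
  · intro ν hν
    have := hpos ν hν
    refine (EN_Av_le hp (hf.Delta s _).1 (hf.Delta s _).2.1 _).trans (hB _ (by positivity) ?_)
    have : (0:ℝ) ≤ ν := by positivity
    nlinarith
  · gcongr
    rw [← choose_abs_sum, Finset.sum_range_succ, add_mul, Finset.sum_mul]
    refine le_add_of_le_of_nonneg ?_ (by positivity)
    apply Finset.sum_le_sum
    intro ν hν
    have := hpos ν hν
    simp only [abs_mul, abs_neg, abs_pow, abs_one, one_pow, one_mul]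
    gcongr
    rw [abs_of_pos (by positivity)]
    apply inv_anti₀ hh
    nlinarith

lemma iteratedDeriv_periodic {g : ℝ → ℝ} (hg : Function.Periodic g 1) (m : ℕ) :
    Function.Periodic (iteratedDeriv m g) 1 := by
  intro x
  have h := iteratedDeriv_comp_add_const m g 1
  have e : (fun z => g (z + 1)) = g := by ext z; exact hg z
  rw [e] at h
  exact (congrFun h x).symm

lemma Delta_deriv (m : ℕ) (h : ℝ) {g : ℝ → ℝ} (hg : Differentiable ℝ g) (x : ℝ) :
    HasDerivAt (Delta m h g) (Delta m h (deriv g) x) x := by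
  unfold Delta
  apply HasDerivAt.fun_sum
  intro i _
  apply HasDerivAt.const_mul
  exact (hg _).hasDerivAt.comp_add_const x _

lemma Delta_bound (h : ℝ) {a b : ℝ} (hab : a ≤ b) (k : ℕ) : ∀ {g : ℝ → ℝ},
    ContDiff ℝ (k+1 : ℕ) g → ∀ y, y ∈ Set.Icc a b → y + ((k:ℝ)+1) * h ∈ Set.Icc a b →
    |Delta (k+1) h g y| ≤ |h|^k * ∫ u in a..b, |iteratedDeriv (k+1) g u| := by
  induction k with
  | zero =>
    intro g hg y hy1 hy2
    simp only [CharP.cast_eq_zero, zero_add, one_mul, pow_zero] at hy2 ⊢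
    have hg1 : ContDiff ℝ 1 g := by simpa using hg
    have hd := contDiff_one_iff_deriv.1 hg1
    have e : Delta 1 h g y = ∫ u in y..(y+h), deriv g u := by
      rw [intervalIntegral.integral_deriv_eq_sub (fun x _ => hd.1 x)
        (hd.2.intervalIntegrable _ _)]
      simp [Delta, Finset.sum_range_succ]
      ring
    rw [e, iteratedDeriv_one]
    have h1 := intervalIntegral.norm_integral_le_abs_integral_norm (f := deriv g) (a := y) (b := y + h)
      (μ := volume)
    refine h1.trans ?_
    have h2 := intervalIntegral.abs_integral_mono_interval (f := fun u => ‖deriv g u‖) (μ := volume)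
      (a := y) (b := y + h) (c := a) (d := b) ?_ ?_ (hd.2.norm.intervalIntegrable _ _)
    · rw [abs_of_nonneg (intervalIntegral.integral_nonneg hab (fun _ _ => norm_nonneg _))] at h2
      exact h2
    · rw [Set.uIoc_of_le hab]
      intro u hu
      rw [Set.mem_uIoc] at hu
      rcases hu with hu | hu
      · exact ⟨by linarith [hu.1, hy1.1], by linarith [hu.2, hy2.2]⟩
      · exact ⟨by linarith [hu.1, hy2.1], by linarith [hu.2, hy1.2]⟩
    · exact Filter.Eventually.of_forall (fun _ => norm_nonneg _)
  | succ k ih =>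
    intro g hg y hy1 hy2
    have hg' : Differentiable ℝ g ∧ ContDiff ℝ (k+1 : ℕ) (deriv g) := by
      have : ContDiff ℝ ((k+1 : ℕ) + 1) g := by exact_mod_cast hg
      have h2 := contDiff_succ_iff_deriv.1 this
      exact ⟨h2.1, h2.2.2⟩
    rw [Delta_succ]
    push_cast at hy2
    have hkey := Convex.norm_image_sub_le_of_norm_deriv_le (𝕜 := ℝ) (f := Delta (k+1) h g)
      (s := Set.uIcc y (y+h)) (x := y) (y := y + h)
      (C := |h|^k * ∫ u in a..b, |iteratedDeriv (k+1) (deriv g) u|)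
      (fun x _ => (Delta_deriv (k+1) h hg'.1 x).differentiableAt) ?_ (convex_uIcc _ _)
      Set.left_mem_uIcc Set.right_mem_uIcc
    · rw [iteratedDeriv_succ']
      simp only [Real.norm_eq_abs, add_sub_cancel_left] at hkey
      refine hkey.trans (le_of_eq ?_)
      rw [pow_succ]; ring
    · intro x hx
      rw [(Delta_deriv (k+1) h hg'.1 x).deriv]
      have hk : (0:ℝ) ≤ k := by positivity
      obtain ⟨hy1a, hy1b⟩ := hy1
      obtain ⟨hy2a, hy2b⟩ := hy2
      apply ih hg'.2
      · rw [Set.mem_uIcc] at hx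
        rcases hx with ⟨hx1, hx2⟩ | ⟨hx1, hx2⟩
        · have : 0 ≤ h := by linarith
          have := mul_nonneg hk this
          constructor <;> nlinarith
        · have : 0 ≤ -h := by linarith
          have := mul_nonneg hk this
          constructor <;> nlinarith
      · rw [Set.mem_uIcc] at hx
        rcases hx with ⟨hx1, hx2⟩ | ⟨hx1, hx2⟩
        · have : 0 ≤ h := by linarith
          have := mul_nonneg hk this
          constructor <;> nlinarith
        · have : 0 ≤ -h := by linarith
          have := mul_nonneg hk this
          constructor <;> nlinarith

lemma Delta_bound_high (h : ℝ) {a b : ℝ} (hab : a ≤ b) (k : ℕ) {g : ℝ → ℝ}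
    (hg : ContDiff ℝ (k+1 : ℕ) g) (j : ℕ) : ∀ y, y ∈ Set.Icc a b →
    y + ((k:ℝ)+1+j) * h ∈ Set.Icc a b →
    |Delta (k+1+j) h g y| ≤ 2^j * (|h|^k * ∫ u in a..b, |iteratedDeriv (k+1) g u|) := by
  induction j with
  | zero =>
    intro y hy1 hy2
    simpa using Delta_bound h hab k hg y hy1 (by simpa using hy2)
  | succ j ih =>
    rintro y ⟨hy1a, hy1b⟩ ⟨hy2a, hy2b⟩
    push_cast at hy2a hy2b
    have hk : (0:ℝ) ≤ k := by positivity
    have hj : (0:ℝ) ≤ j := by positivity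
    rw [← add_assoc, Delta_succ]
    have h1 := ih (y + h) ?_ ?_
    · have h2 := ih y ⟨hy1a, hy1b⟩ ?_
      · rw [pow_succ]
        have := abs_sub (Delta (k+1+j) h g (y+h)) (Delta (k+1+j) h g y)
        linarith
      · rcases le_total 0 h with hh | hh
        · have := mul_nonneg hk hh
          have := mul_nonneg hj hh
          constructor <;> nlinarith
        · have := mul_nonneg hk (neg_nonneg.2 hh)
          have := mul_nonneg hj (neg_nonneg.2 hh)
          constructor <;> nlinarith
    · rcases le_total 0 h with hh | hh
      · have := mul_nonneg hk hh
        have := mul_nonneg hj hh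
        constructor <;> nlinarith
      · have := mul_nonneg hk (neg_nonneg.2 hh)
        have := mul_nonneg hj (neg_nonneg.2 hh)
        constructor <;> nlinarith
    · constructor <;> nlinarith

lemma EN_abs (p : ℝ) (f : ℝ → ℝ) : EN p (fun x => |f x|) = EN p f := by
  unfold EN
  exact eLpNorm_norm f

lemma EN_Delta_smooth {p : ℝ} (hp : 1 ≤ p) {h : ℝ} (hh : 0 < h) {k : ℕ} {g : ℝ → ℝ}
    (hper : Function.Periodic g 1) (hg : ContDiff ℝ (k+1 : ℕ) g) :
    EN p (Delta (k+1) h g) ≤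
      ENNReal.ofReal (((k:ℝ)+1) * h^(k+1)) * EN p (iteratedDeriv (k+1) g) := by
  have hc : Continuous (iteratedDeriv (k+1) g) := hg.continuous_iteratedDeriv (k+1) le_rfl
  have hperk := iteratedDeriv_periodic hper (k+1)
  set G : ℝ → ℝ := fun u => |iteratedDeriv (k+1) g u| with hG
  have hGp : Function.Periodic G 1 := fun x => by simp [hG, hperk x]
  have h1 : EN p (Delta (k+1) h g) ≤
      EN p (fun x => (((k:ℝ)+1) * h^(k+1)) * Av (((k:ℝ)+1)*h) G x) := by
    apply eLpNorm_mono_real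
    intro x
    have hle : x ≤ x + ((k:ℝ)+1) * h := by
      have : 0 ≤ ((k:ℝ)+1) * h := by positivity
      linarith
    have := Delta_bound h hle k hg x (Set.left_mem_Icc.2 hle) (Set.right_mem_Icc.2 hle)
    rw [Av_eq (by positivity), Real.norm_eq_abs]
    refine this.trans (le_of_eq ?_)
    rw [abs_of_pos hh]
    rw [pow_succ]
    field_simp
    simp [hG]
  refine h1.trans ((EN_const_mul _ _).trans ?_)
  rw [abs_of_pos (by positivity)]
  gcongr
  refine (EN_Av_le hp hGp hc.abs.measurable _).trans (le_of_eq ?_)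
  exact EN_abs p _

lemma Av_jensen {p : ℝ} (hp : 1 ≤ p) {F : ℝ → ℝ} (hF : MemLpT p F) {δ : ℝ} (a : ℝ) :
    (Av δ (fun x => |F x|) a) ^ p ≤ Av δ (fun x => |F x| ^ p) a := by
  have hG := good_of_memLpT hp hF
  have hG1 : Good (fun x => |F x|) :=
    ⟨fun x => by simp [hF.1 x], hF.2.1.abs, fun a b => (hG.2.2 a b).abs⟩
  have hG2 : Good (fun x => |F x| ^ p) := by
    have hper : Function.Periodic (fun x => |F x| ^ p) 1 := fun x => by simp [hF.1 x]
    refine ⟨hper, hF.2.1.abs.pow_const p, fun a b => ?_⟩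
    have h3 : IntervalIntegrable (fun x => |F x| ^ p) volume 0 (0+1) := by
      rw [zero_add]; exact hF.2.2
    exact hper.intervalIntegrable one_ne_zero h3 a b
  unfold Av
  exact ConvexOn.map_integral_le (convexOn_rpow hp)
    (Real.continuous_rpow_const (by linarith)).continuousOn isClosed_Ici
    (Filter.Eventually.of_forall fun _ => Set.mem_Ici.2 (abs_nonneg _)) (hG1.integrable a δ) (hG2.integrable a δ)

lemma sum_intervals {G : ℝ → ℝ} (hG : ∀ a b, IntervalIntegrable G volume a b) (hG0 : ∀ x, 0 ≤ G x)
    {δ : ℝ} (a : ℕ → ℝ) (m : ℕ) (ha : ∀ k, k + 1 ≤ m → a k + δ ≤ a (k+1)) :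
    ∑ k ∈ Finset.range (m+1), ∫ y in (a k)..(a k + δ), G y ≤ ∫ y in (a 0)..(a m + δ), G y := by
  induction m with
  | zero => simp
  | succ m ih =>
    rw [Finset.sum_range_succ]
    have h1 := ih (fun k hk => ha k (by omega))
    have h2 := ha m le_rfl
    have h3 : ∫ y in (a 0)..(a (m+1) + δ), G y = (∫ y in (a 0)..(a m + δ), G y) +
        (∫ y in (a m + δ)..(a (m+1)), G y) + ∫ y in (a (m+1))..(a (m+1) + δ), G y := by
      rw [intervalIntegral.integral_add_adjacent_intervals (hG _ _) (hG _ _),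
        intervalIntegral.integral_add_adjacent_intervals (hG _ _) (hG _ _)]
    have h4 : 0 ≤ ∫ y in (a m + δ)..(a (m+1)), G y :=
      intervalIntegral.integral_nonneg h2 (fun _ _ => hG0 _)
    linarith

lemma sampling {p γ : ℝ} (hp : 1 ≤ p) (hγ0 : 0 < γ) (hγ1 : γ ≤ 1) {X : ℕ → ℕ → ℝ}
    (hX : NodesOK γ X) {n : ℕ} (hn : 1 ≤ n) {F φ : ℝ → ℝ} (hF : MemLpT p F) {C : ℝ} (hC : 0 ≤ C)
    (hφ : ∀ x, |φ x| ≤ C * Av (γ / n) (fun y => |F y|) (x - γ / n / 2)) :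
    ellp p n (X n) φ ≤ C * γ⁻¹ * LpNorm p F := by
  have hp0 : 0 < p := by linarith
  have hn0 : (0:ℝ) < n := by exact_mod_cast hn
  set δ := γ / n with hδd
  have hδ : 0 < δ := by positivity
  set G : ℝ → ℝ := fun x => |F x| ^ p with hGd
  have hG0 : ∀ x, 0 ≤ G x := fun x => by positivity
  have hper : Function.Periodic G 1 := fun x => by simp [hGd, hF.1 x]
  have hGi : ∀ a b, IntervalIntegrable G volume a b := by
    have h3 : IntervalIntegrable G volume 0 (0+1) := by
      rw [zero_add]; exact hF.2.2
    exact hper.intervalIntegrable one_ne_zero h3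
  set I := ∫ x in (0:ℝ)..1, |F x| ^ p with hI
  have hI0 : 0 ≤ I := intervalIntegral.integral_nonneg zero_le_one (fun _ _ => by positivity)
  have hterm : ∀ k, |φ (X n k)| ^ p ≤
      C ^ p * δ⁻¹ * ∫ y in (X n k - δ/2)..(X n k - δ/2 + δ), G y := by
    intro k
    have hAv0 : 0 ≤ Av δ (fun y => |F y|) (X n k - δ/2) :=
      integral_nonneg (fun _ => abs_nonneg _)
    calc |φ (X n k)| ^ p ≤ (C * Av δ (fun y => |F y|) (X n k - δ/2)) ^ p := by
          gcongr; exact hφ _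
      _ = C ^ p * (Av δ (fun y => |F y|) (X n k - δ/2)) ^ p := Real.mul_rpow hC hAv0
      _ ≤ C ^ p * Av δ G (X n k - δ/2) := by
          gcongr; exact Av_jensen hp hF _
      _ = _ := by rw [Av_eq hδ.ne', mul_assoc]
  obtain ⟨m, rfl⟩ : ∃ m, n = m + 1 := ⟨n - 1, by omega⟩
  obtain ⟨-, -, -, hgap, hlast⟩ := hX (m+1) hn
  have hsum : ∑ k ∈ Finset.range (m+1), ∫ y in (X (m+1) k - δ/2)..(X (m+1) k - δ/2 + δ), G y
      ≤ I := by
    have h1 := sum_intervals hGi hG0 (δ := δ) (fun k => X (m+1) k - δ/2) m (by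
      intro k hk
      have := hgap k (by omega)
      linarith)
    refine h1.trans ?_
    have h2 := hper.intervalIntegral_add_eq (X (m+1) 0 - δ/2) 0
    rw [zero_add] at h2
    rw [hI, ← h2]
    simp only [Nat.add_sub_cancel] at hlast
    have h3 := intervalIntegral.integral_add_adjacent_intervals
      (hGi (X (m+1) 0 - δ/2) (X (m+1) m - δ/2 + δ))
      (hGi (X (m+1) m - δ/2 + δ) (X (m+1) 0 - δ/2 + 1))
    have h4 : 0 ≤ ∫ y in (X (m+1) m - δ/2 + δ)..(X (m+1) 0 - δ/2 + 1), G y :=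
      intervalIntegral.integral_nonneg (by linarith) (fun _ _ => hG0 _)
    linarith
  have htot : (1 / ((m+1 : ℕ) : ℝ)) * ∑ k ∈ Finset.range (m+1), |φ (X (m+1) k)| ^ p
      ≤ C ^ p * γ⁻¹ * I := by
    calc _ ≤ (1 / ((m+1 : ℕ) : ℝ)) * ∑ k ∈ Finset.range (m+1),
          C ^ p * δ⁻¹ * ∫ y in (X (m+1) k - δ/2)..(X (m+1) k - δ/2 + δ), G y := by
            gcongr with k _; exact hterm k
      _ = (1 / ((m+1 : ℕ) : ℝ)) * (C ^ p * δ⁻¹ * ∑ k ∈ Finset.range (m+1),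
          ∫ y in (X (m+1) k - δ/2)..(X (m+1) k - δ/2 + δ), G y) := by
            rw [Finset.mul_sum (Finset.range (m+1)) _ (C ^ p * δ⁻¹)]
      _ ≤ (1 / ((m+1 : ℕ) : ℝ)) * (C ^ p * δ⁻¹ * I) := by gcongr
      _ = C ^ p * γ⁻¹ * I := by rw [hδd]; field_simp
  unfold ellp LpNorm
  calc _ ≤ (C ^ p * γ⁻¹ * I) ^ (1 / p) := by gcongr
    _ = C * (γ⁻¹) ^ (1/p) * I ^ (1/p) := by
        rw [Real.mul_rpow (by positivity) hI0, Real.mul_rpow (by positivity) (by positivity),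
          ← Real.rpow_mul hC, mul_one_div_cancel hp0.ne', Real.rpow_one]
    _ ≤ C * γ⁻¹ * I ^ (1/p) := by
        gcongr
        have h1 : 1 ≤ γ⁻¹ := (one_le_inv₀ hγ0).2 hγ1
        calc (γ⁻¹) ^ (1/p) ≤ (γ⁻¹) ^ (1:ℝ) := by
              apply Real.rpow_le_rpow_of_exponent_le h1
              rw [div_le_one hp0]; exact hp
          _ = γ⁻¹ := Real.rpow_one _

lemma ellp_add_le {p : ℝ} (hp : 1 ≤ p) (n : ℕ) (x : ℕ → ℝ) (f g : ℝ → ℝ) :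
    ellp p n x (fun t => f t + g t) ≤ ellp p n x f + ellp p n x g := by
  unfold ellp
  rw [Real.mul_rpow (by positivity) (by positivity), Real.mul_rpow (by positivity) (by positivity),
    Real.mul_rpow (by positivity) (by positivity), ← mul_add]
  gcongr
  exact Real.Lp_add_le _ _ _ hp

lemma ellp_neg (p : ℝ) (n : ℕ) (x : ℕ → ℝ) (f : ℝ → ℝ) :
    ellp p n x (fun t => - f t) = ellp p n x f := by
  simp [ellp]

/-- Single dilate integral. -/
lemma dilate_integrable {F : ℝ → ℝ} (hF : Good F) (x c a : ℝ) :
    IntervalIntegrable (fun t => F (x + c * t)) volume (-a) a := by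
  rcases eq_or_ne c 0 with rfl | hc
  · simp
  have h0 : IntervalIntegrable F volume (c * (-a) + x) (c * a + x) := hF.2.2 _ _
  have h2 := (h0.comp_add_right x).comp_mul_left (c := c)
  convert h2 using 1
  · ext u; rw [add_comm]
  · field_simp; ring
  · field_simp; ring

lemma steklov_sub {r : ℕ} {δ : ℝ} {f g : ℝ → ℝ} (hf : Good f) (hg : Good g) (x : ℝ) :
    steklov r δ (fun t => f t - g t) x = steklov r δ f x - steklov r δ g x := by
  unfold steklov
  rw [← mul_sub, ← intervalIntegral.integral_sub]
  · congr 2; ext t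
    rw [← Finset.sum_sub_distrib]
    apply Finset.sum_congr rfl
    intros; ring
  all_goals
    rw [← Finset.sum_fn]
    apply IntervalIntegrable.sum
    intro i _
    apply IntervalIntegrable.const_mul
    apply dilate_integrable
    assumption

lemma steklov_bound {r : ℕ} (hr : 1 ≤ r) {δ : ℝ} (hδ : 0 < δ) {F : ℝ → ℝ} (hF : Good F) (x : ℝ) :
    |steklov r δ F x| ≤
      (2 * (∑ ν ∈ Finset.range r, ((2*r).choose ν : ℝ)) * r) *
        Av δ (fun y => |F y|) (x - δ/2) := by
  have hr0 : (0:ℝ) < r := by exact_mod_cast hr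
  have hG1 : Good (fun x => |F x|) :=
    ⟨fun x => by simp [hF.1 x], hF.2.1.abs, fun a b => (hF.2.2 a b).abs⟩
  set J := ∫ y in (x - δ/2)..(x - δ/2 + δ), |F y| with hJ
  have hJ0 : 0 ≤ J := intervalIntegral.integral_nonneg (by linarith) (fun _ _ => abs_nonneg _)
  have hν : ∀ ν ∈ Finset.range r,
      ∫ t in (-(δ/2))..(δ/2), |F (x + (((r:ℝ) - ν)/r) * t)| ≤ r * J := by
    intro ν hν
    have h1 : (ν:ℝ) + 1 ≤ r := by exact_mod_cast Finset.mem_range.1 hν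
    have hν0 : (0:ℝ) ≤ ν := by positivity
    set c := ((r:ℝ) - ν)/r with hc
    have hc0 : 0 < c := by apply div_pos <;> linarith
    have hc1 : c ≤ 1 := by rw [hc, div_le_one hr0]; linarith
    have hcr : c⁻¹ ≤ r := by
      rw [hc, inv_div, div_le_iff₀ (by linarith)]
      nlinarith
    rw [intervalIntegral.integral_comp_add_mul (fun y => |F y|) hc0.ne' x, smul_eq_mul]
    refine mul_le_mul hcr ?_ (intervalIntegral.integral_nonneg (by nlinarith)
      (fun _ _ => abs_nonneg _)) hr0.le
    rw [hJ]
    apply intervalIntegral.integral_mono_interval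
    · nlinarith
    · nlinarith
    · nlinarith
    · exact Filter.Eventually.of_forall (fun _ => abs_nonneg _)
    · exact hG1.2.2 _ _
  have hint : |∫ t in (-(δ / 2))..(δ / 2), ∑ ν ∈ Finset.range r,
        (-1 : ℝ) ^ ν * (((2 * r).choose ν : ℝ)) * F (x + (((r : ℝ) - (ν : ℝ)) / (r : ℝ)) * t)|
      ≤ (∑ ν ∈ Finset.range r, ((2*r).choose ν : ℝ)) * (r * J) := by
    rw [intervalIntegral.integral_finsetSum
      (fun i _ => (dilate_integrable hF x _ _).const_mul _), Finset.sum_mul]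
    refine (Finset.abs_sum_le_sum_abs _ _).trans (Finset.sum_le_sum fun ν h => ?_)
    rw [intervalIntegral.integral_const_mul, abs_mul]
    have e : |(-1:ℝ)^ν * ((2*r).choose ν : ℝ)| = ((2*r).choose ν : ℝ) := by simp [abs_mul]
    rw [e]
    gcongr
    refine le_trans ?_ (hν ν h)
    exact intervalIntegral.abs_integral_le_integral_abs (by linarith)
  unfold steklov
  rw [abs_mul, Av_eq hδ.ne', ← hJ]
  have hcoef : |(-1 : ℝ) ^ (r + 1) * (((2 * r).choose r : ℝ))⁻¹ * (2 / δ)| ≤ 2 / δ := by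
    simp only [abs_mul, abs_pow, abs_neg, abs_one, one_pow, one_mul]
    rw [abs_of_pos (show 0 < 2/δ by positivity)]
    apply mul_le_of_le_one_left (by positivity)
    have : (1:ℝ) ≤ (2*r).choose r := by
      exact_mod_cast Nat.choose_pos (by omega)
    rw [abs_of_nonneg (by positivity)]
    exact inv_le_one_of_one_le₀ this
  calc _ ≤ (2/δ) * ((∑ ν ∈ Finset.range r, ((2*r).choose ν : ℝ)) * (r * J)) := by gcongr
    _ = _ := by field_simp

lemma steklov_sub_self {r : ℕ} (hr : 1 ≤ r) {δ : ℝ} (hδ : 0 < δ) {g : ℝ → ℝ} (hg : Continuous g)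
    (x : ℝ) : steklov r δ g x - g x = (-1:ℝ)^(r+1) * (((2 * r).choose r : ℝ))⁻¹ * δ⁻¹ *
      ∫ t in (-(δ / 2))..(δ / 2), Delta (2*r) (t / r) g (x - t) := by
  have hr0 : (0:ℝ) < r := by exact_mod_cast hr
  set I : ℕ → ℝ := fun ν => ∫ t in (-(δ / 2))..(δ / 2), g (x + (((r : ℝ) - (ν : ℝ)) / r) * t) with hI
  set c : ℕ → ℝ := fun ν => (-1 : ℝ) ^ ν * (((2 * r).choose ν : ℝ)) with hc
  have e1 : ∫ t in (-(δ / 2))..(δ / 2), Delta (2*r) (t / r) g (x - t) =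
      ∑ ν ∈ Finset.range (2*r+1), c ν * I ν := by
    unfold Delta
    rw [intervalIntegral.integral_finsetSum]
    · apply Finset.sum_congr rfl
      intro ν _
      rw [intervalIntegral.integral_const_mul]
      congr 2; ext t; congr 1
      push_cast; field_simp; ring
    · intro i _
      apply Continuous.intervalIntegrable
      fun_prop
  have e2 : ∫ t in (-(δ / 2))..(δ / 2), ∑ ν ∈ Finset.range r,
        (-1 : ℝ) ^ ν * (((2 * r).choose ν : ℝ)) * g (x + (((r : ℝ) - (ν : ℝ)) / (r : ℝ)) * t) =
      ∑ ν ∈ Finset.range r, c ν * I ν := by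
    rw [intervalIntegral.integral_finsetSum]
    · apply Finset.sum_congr rfl
      intro ν _
      rw [intervalIntegral.integral_const_mul]
    · intro i _
      apply Continuous.intervalIntegrable
      fun_prop
  have hIr : I r = δ * g x := by simp [hI]
  have hsym : ∀ ν ≤ 2*r, c (2*r - ν) * I (2*r - ν) = c ν * I ν := by
    intro ν hν
    have hI' : I (2*r-ν) = I ν := by
      simp only [hI]
      have := intervalIntegral.integral_comp_neg (a := -(δ/2)) (b := δ/2)
        (fun t => g (x + (((r : ℝ) - (ν : ℝ)) / r) * t))
      rw [neg_neg] at this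
      rw [← this]
      congr 1; ext t; congr 1
      rw [Nat.cast_sub hν]; push_cast; ring
    have hc' : c (2*r-ν) = c ν := by
      simp only [hc]
      rw [Nat.choose_symm hν]
      congr 1
      have h1 : (-1:ℝ)^(2*r-ν) * (-1)^ν = 1 := by
        rw [← pow_add, Nat.sub_add_cancel hν, pow_mul]; simp
      have h2 : (-1:ℝ)^ν * (-1)^ν = 1 := by
        rw [← pow_add, ← two_mul, pow_mul]; simp
      have h3 : (-1:ℝ)^ν ≠ 0 := by simp
      exact mul_right_cancel₀ h3 (h1.trans h2.symm)
    rw [hI', hc']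
  have e3 : ∑ ν ∈ Finset.range (2*r+1), c ν * I ν =
      2 * (∑ ν ∈ Finset.range r, c ν * I ν) + c r * I r := by
    have : 2*r+1 = (r+1) + r := by ring
    rw [this, Finset.sum_range_add, Finset.sum_range_succ]
    have : ∑ i ∈ Finset.range r, c (r+1+i) * I (r+1+i) = ∑ ν ∈ Finset.range r, c ν * I ν := by
      rw [← Finset.sum_range_reflect]
      apply Finset.sum_congr rfl
      intro i hi
      have hi' := Finset.mem_range.1 hi
      rw [← hsym i (by omega)]
      have : r + 1 + (r - 1 - i) = 2*r - i := by omega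
      rw [this]
    rw [this]; ring
  unfold steklov
  rw [e1, e2, e3, hIr]
  have hcr : c r = (-1:ℝ)^r * ((2*r).choose r : ℝ) := rfl
  have hch : ((2*r).choose r : ℝ) ≠ 0 := by
    exact_mod_cast (Nat.choose_pos (by omega)).ne'
  have h2 : (-1:ℝ)^r * (-1)^r = 1 := by
    rw [← pow_add, ← two_mul, pow_mul]; simp
  rw [hcr, pow_succ]
  field_simp
  linear_combination (((2*r).choose r : ℝ) * g x * δ) * h2

lemma steklov_smooth {r k : ℕ} (hr : 1 ≤ r) (hk : k + 1 ≤ 2 * r) {δ : ℝ} (hδ : 0 < δ) {g : ℝ → ℝ}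
    (hg : ContDiff ℝ (k+1 : ℕ) g) (x : ℝ) :
    |steklov r δ g x - g x| ≤ (4 ^ r * δ ^ (k+1)) *
      Av δ (fun y => |iteratedDeriv (k+1) g y|) (x - δ/2) := by
  have hr1 : (1:ℝ) ≤ r := by exact_mod_cast hr
  have hr0 : (0:ℝ) < r := by linarith
  set J := ∫ y in (x - δ/2)..(x - δ/2 + δ), |iteratedDeriv (k+1) g y| with hJ
  have hJ0 : 0 ≤ J := intervalIntegral.integral_nonneg (by linarith) (fun _ _ => abs_nonneg _)
  obtain ⟨j, hj⟩ : ∃ j, 2*r = k+1+j := ⟨2*r-(k+1), by omega⟩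
  have hjr : (2:ℝ)*r = k+1+j := by exact_mod_cast hj
  have hint : ‖∫ t in (-(δ / 2))..(δ / 2), Delta (2*r) (t / r) g (x - t)‖ ≤
      (4^r * (δ^k * J)) * |δ/2 - (-(δ/2))| := by
    apply intervalIntegral.norm_integral_le_of_norm_le_const
    intro t ht
    rw [Set.uIoc_of_le (by linarith)] at ht
    have h1 : x - t + ((k:ℝ)+1+j) * (t/r) = x + t := by
      rw [← hjr]; field_simp; ring
    have := Delta_bound_high (t/r) (a := x - δ/2) (b := x - δ/2 + δ) (by linarith) k hg j (x - t)
      ⟨by linarith [ht.2], by linarith [ht.1]⟩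
      (by rw [h1]; exact ⟨by linarith [ht.1], by linarith [ht.2]⟩)
    rw [hj, Real.norm_eq_abs]
    refine this.trans ?_
    rw [← hJ]
    have ht' : |t / r| ≤ δ := by
      rw [abs_div, abs_of_pos hr0, div_le_iff₀ hr0]
      have : |t| ≤ δ/2 := abs_le.2 ⟨by linarith [ht.1], ht.2⟩
      nlinarith
    have h4 : (2:ℝ)^j ≤ 4^r := by
      have : (4:ℝ)^r = 2^(2*r) := by rw [pow_mul]; norm_num
      rw [this]
      exact pow_le_pow_right₀ (by norm_num) (by omega)
    gcongr
  rw [steklov_sub_self hr hδ hg.continuous, abs_mul, Av_eq hδ.ne', ← hJ]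
  have hcoef : |(-1 : ℝ) ^ (r + 1) * (((2 * r).choose r : ℝ))⁻¹ * δ⁻¹| ≤ δ⁻¹ := by
    simp only [abs_mul, abs_pow, abs_neg, abs_one, one_pow, one_mul]
    rw [abs_of_pos (show 0 < δ⁻¹ by positivity)]
    apply mul_le_of_le_one_left (by positivity)
    have : (1:ℝ) ≤ (2*r).choose r := by
      exact_mod_cast Nat.choose_pos (by omega)
    rw [abs_of_nonneg (by positivity)]
    exact inv_le_one_of_one_le₀ this
  have hab : |δ/2 - (-(δ/2))| = δ := by rw [abs_of_pos] <;> linarith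
  rw [hab, Real.norm_eq_abs] at hint
  calc _ ≤ δ⁻¹ * ((4^r * (δ^k * J)) * δ) := by gcongr
    _ = _ := by rw [pow_succ]; ring

lemma omega_bdd {p : ℝ} (hp : 1 ≤ p) {f : ℝ → ℝ} (hf : MemLpT p f) (s : ℕ) (δ : ℝ) :
    BddAbove {y | ∃ h : ℝ, 0 < h ∧ h < δ ∧ y = LpNorm p (Delta s h f)} := by
  refine ⟨(ENNReal.ofReal (2 ^ s) * EN p f).toReal, ?_⟩
  rintro y ⟨h, -, -, rfl⟩
  rw [LpNorm_eq hp (Delta_meas s h hf.2.1)]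
  apply ENNReal.toReal_mono
  · exact ENNReal.mul_ne_top ENNReal.ofReal_ne_top (EN_lt_top hp hf).ne
  · exact EN_Delta_le hp s h hf.1 hf.2.1

lemma omega_nonneg (p : ℝ) (s : ℕ) (f : ℝ → ℝ) (δ : ℝ) : 0 ≤ omegaMod s p f δ := by
  apply Real.sSup_nonneg
  rintro y ⟨h, -, -, rfl⟩
  exact LpNorm_nonneg _ _

lemma EN_Delta_le_omega {p : ℝ} (hp : 1 ≤ p) {f : ℝ → ℝ} (hf : MemLpT p f) (s : ℕ) {δ v : ℝ}
    (hv : 0 < v) (hvδ : v < δ) : EN p (Delta s v f) ≤ ENNReal.ofReal (omegaMod s p f δ) := by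
  have hfin : EN p (Delta s v f) ≠ ⊤ :=
    ((EN_Delta_le hp s v hf.1 hf.2.1).trans_lt
      (ENNReal.mul_lt_top ENNReal.ofReal_lt_top (EN_lt_top hp hf))).ne
  rw [← ENNReal.ofReal_toReal hfin, ← LpNorm_eq hp (Delta_meas s v hf.2.1)]
  apply ENNReal.ofReal_le_ofReal
  exact le_csSup (omega_bdd hp hf s δ) ⟨v, hv, hvδ, rfl⟩

lemma sobolev_cd {k : ℕ} {g : ℝ → ℝ} (hg : SobolevW (k+1) g) : ContDiff ℝ (k+1 : ℕ) g := hg.2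

lemma sobolev_memLpT {p : ℝ} (hp : 1 ≤ p) {k : ℕ} {g : ℝ → ℝ} (hg : SobolevW (k+1) g) :
    MemLpT p g := memLpT_of_cont hp hg.1 (sobolev_cd hg).continuous

lemma sobolev_deriv_cont {k : ℕ} {g : ℝ → ℝ} (hg : SobolevW (k+1) g) :
    Continuous (iteratedDeriv (k+1) g) := (sobolev_cd hg).continuous_iteratedDeriv (k+1) le_rfl

lemma sobolev_deriv_memLpT {p : ℝ} (hp : 1 ≤ p) {k : ℕ} {g : ℝ → ℝ} (hg : SobolevW (k+1) g) :
    MemLpT p (iteratedDeriv (k+1) g) :=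
  memLpT_of_cont hp (iteratedDeriv_periodic hg.1 _) (sobolev_deriv_cont hg)

lemma memLpT_sub {p : ℝ} (hp : 1 ≤ p) {f g : ℝ → ℝ} (hf : MemLpT p f) (hg : MemLpT p g) :
    MemLpT p (fun t => f t - g t) := by
  apply memLpT_of_EN hp
  · intro x; simp only [hf.1 x, hg.1 x]
  · exact hf.2.1.sub hg.2.1
  · have h1 := (integrable_pow_iff hp hf.2.1).1 hf.2.2
    have h2 := (integrable_pow_iff hp hg.2.1).1 hg.2.2
    exact (h1.sub h2).2

section main
variable {p γ : ℝ} {r k n : ℕ} {X : ℕ → ℕ → ℝ} {f g : ℝ → ℝ}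

lemma ellp_steklov_le (hp : 1 ≤ p) (hγ0 : 0 < γ) (hγ1 : γ ≤ 1) (hX : NodesOK γ X) (hn : 1 ≤ n)
    (hr : 1 ≤ r) (hf : MemLpT p f) :
    ellp p n (X n) (steklov r (γ / (n:ℝ)) f) ≤
      (2 * (∑ ν ∈ Finset.range r, ((2*r).choose ν : ℝ)) * r) * γ⁻¹ * LpNorm p f := by
  have hn0 : (0:ℝ) < n := by exact_mod_cast hn
  exact sampling hp hγ0 hγ1 hX hn hf (by positivity)
    (fun x => steklov_bound hr (by positivity) (good_of_memLpT hp hf) x)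

lemma ellp_steklov_smooth (hp : 1 ≤ p) (hγ0 : 0 < γ) (hγ1 : γ ≤ 1) (hX : NodesOK γ X)
    (hn : 1 ≤ n) (hr : 1 ≤ r) (hk : k + 1 ≤ 2 * r) (hg : SobolevW (k+1) g) :
    ellp p n (X n) (fun x => steklov r (γ / (n:ℝ)) g x - g x) ≤
      4 ^ r * γ⁻¹ * ((1 / (n:ℝ) ^ (k+1)) * LpNorm p (iteratedDeriv (k+1) g)) := by
  have hn0 : (0:ℝ) < n := by exact_mod_cast hn
  have hδ : 0 < γ / (n:ℝ) := by positivity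
  refine (sampling hp hγ0 hγ1 hX hn (sobolev_deriv_memLpT hp hg) (by positivity)
    (fun x => steklov_smooth hr hk hδ (sobolev_cd hg) x)).trans ?_
  have h1 : (γ / (n:ℝ)) ^ (k+1) ≤ 1 / (n:ℝ) ^ (k+1) := by
    rw [div_pow]
    gcongr
    exact pow_le_one₀ hγ0.le hγ1
  have h2 := LpNorm_nonneg p (iteratedDeriv (k+1) g)
  calc _ = 4 ^ r * γ⁻¹ * ((γ / (n:ℝ)) ^ (k+1) * LpNorm p (iteratedDeriv (k+1) g)) := by ring
    _ ≤ _ := by gcongr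

lemma ellp_lower (hp : 1 ≤ p) (hγ0 : 0 < γ) (hγ1 : γ ≤ 1) (hX : NodesOK γ X)
    (hn : 1 ≤ n) (hr : 1 ≤ r) (hk : k + 1 ≤ 2 * r) (hf : MemLpT p f) (hg : SobolevW (k+1) g) :
    ellp p n (X n) (fun x => steklov r (γ / (n:ℝ)) f x - f x) ≤
      (2 * (∑ ν ∈ Finset.range r, ((2*r).choose ν : ℝ)) * r) * γ⁻¹ * LpNorm p (fun t => f t - g t)
      + 4 ^ r * γ⁻¹ * ((1 / (n:ℝ) ^ (k+1)) * LpNorm p (iteratedDeriv (k+1) g))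
      + ellp p n (X n) (fun t => f t - g t) := by
  have hgm := sobolev_memLpT hp hg
  have h1 := ellp_steklov_le hp hγ0 hγ1 hX hn hr (memLpT_sub hp hf hgm)
  have h2 := ellp_steklov_smooth hp hγ0 hγ1 hX hn hr hk hg
  have e : (fun x => steklov r (γ / (n:ℝ)) f x - f x) = fun x =>
      (steklov r (γ / (n:ℝ)) (fun t => f t - g t) x + (steklov r (γ / (n:ℝ)) g x - g x))
        + -(f x - g x) := by
    ext x
    rw [steklov_sub (good_of_memLpT hp hf) (good_of_memLpT hp hgm)]; ring
  rw [e]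
  refine (ellp_add_le hp n (X n) _ _).trans ?_
  rw [ellp_neg p n (X n) (fun t => f t - g t)]
  have h3 := ellp_add_le hp n (X n) (steklov r (γ / (n:ℝ)) (fun t => f t - g t))
    (fun x => steklov r (γ / (n:ℝ)) g x - g x)
  linarith

lemma ellp_upper (hp : 1 ≤ p) (hγ0 : 0 < γ) (hγ1 : γ ≤ 1) (hX : NodesOK γ X)
    (hn : 1 ≤ n) (hr : 1 ≤ r) (hk : k + 1 ≤ 2 * r) (hf : MemLpT p f) (hg : SobolevW (k+1) g) :
    ellp p n (X n) (fun t => f t - g t) ≤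
      (2 * (∑ ν ∈ Finset.range r, ((2*r).choose ν : ℝ)) * r) * γ⁻¹ * LpNorm p (fun t => f t - g t)
      + 4 ^ r * γ⁻¹ * ((1 / (n:ℝ) ^ (k+1)) * LpNorm p (iteratedDeriv (k+1) g))
      + ellp p n (X n) (fun x => steklov r (γ / (n:ℝ)) f x - f x) := by
  have hgm := sobolev_memLpT hp hg
  have h1 := ellp_steklov_le hp hγ0 hγ1 hX hn hr (memLpT_sub hp hf hgm)
  have h2 := ellp_steklov_smooth hp hγ0 hγ1 hX hn hr hk hg
  have e : (fun x => f x - g x) = fun x =>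
      (steklov r (γ / (n:ℝ)) (fun t => f t - g t) x + (steklov r (γ / (n:ℝ)) g x - g x))
        + -(steklov r (γ / (n:ℝ)) f x - f x) := by
    ext x
    rw [steklov_sub (good_of_memLpT hp hf) (good_of_memLpT hp hgm)]; ring
  calc ellp p n (X n) (fun t => f t - g t)
      = ellp p n (X n) (fun x =>
      (steklov r (γ / (n:ℝ)) (fun t => f t - g t) x + (steklov r (γ / (n:ℝ)) g x - g x))
        + -(steklov r (γ / (n:ℝ)) f x - f x)) := congrArg _ e
    _ ≤ _ := ellp_add_le hp n (X n) _ _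
    _ ≤ _ := by
      rw [ellp_neg p n (X n) (fun x => steklov r (γ / (n:ℝ)) f x - f x)]
      have h3 := ellp_add_le hp n (X n) (steklov r (γ / (n:ℝ)) (fun t => f t - g t))
        (fun x => steklov r (γ / (n:ℝ)) g x - g x)
      linarith

lemma omega_lower (hp : 1 ≤ p) (hn : 1 ≤ n) (hf : MemLpT p f) (hg : SobolevW (k+1) g) :
    omegaMod (k+1) p f (1 / (n:ℝ)) ≤ 2 ^ (k+1) * LpNorm p (fun t => f t - g t) +
      ((k:ℝ)+1) * ((1 / (n:ℝ) ^ (k+1)) * LpNorm p (iteratedDeriv (k+1) g)) := by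
  have hn0 : (0:ℝ) < n := by exact_mod_cast hn
  have hgm := sobolev_memLpT hp hg
  have hdm := sobolev_deriv_memLpT hp hg
  have hfg := memLpT_sub hp hf hgm
  apply csSup_le
  · exact ⟨_, 1 / (n:ℝ) / 2, by positivity, half_lt_self (by positivity), rfl⟩
  rintro y ⟨h, hh, hhn, rfl⟩
  have e : Delta (k+1) h f = Delta (k+1) h (fun t => f t - g t) + Delta (k+1) h g := by
    ext x
    simp only [Delta, Pi.add_apply]
    rw [← Finset.sum_add_distrib]
    apply Finset.sum_congr rfl
    intros; ring
  have h1 : EN p (Delta (k+1) h f) ≤ ENNReal.ofReal (2 ^ (k+1)) * EN p (fun t => f t - g t) +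
      ENNReal.ofReal (((k:ℝ)+1) * h^(k+1)) * EN p (iteratedDeriv (k+1) g) := by
    rw [e]
    refine (eLpNorm_add_le (Delta_meas _ _ hfg.2.1).aestronglyMeasurable
      (Delta_meas _ _ hgm.2.1).aestronglyMeasurable (one_le_ofReal_p hp)).trans ?_
    exact add_le_add (EN_Delta_le hp _ _ hfg.1 hfg.2.1)
      (EN_Delta_smooth hp hh hg.1 (sobolev_cd hg))
  have hA : ENNReal.ofReal (2 ^ (k+1)) * EN p (fun t => f t - g t) ≠ ⊤ :=
    ENNReal.mul_ne_top ENNReal.ofReal_ne_top (EN_lt_top hp hfg).ne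
  have hB : ENNReal.ofReal (((k:ℝ)+1) * h^(k+1)) * EN p (iteratedDeriv (k+1) g) ≠ ⊤ :=
    ENNReal.mul_ne_top ENNReal.ofReal_ne_top (EN_lt_top hp hdm).ne
  have h2 := ENNReal.toReal_mono (ENNReal.add_ne_top.2 ⟨hA, hB⟩) h1
  rw [ENNReal.toReal_add hA hB, ENNReal.toReal_mul, ENNReal.toReal_mul,
    ENNReal.toReal_ofReal (by positivity), ENNReal.toReal_ofReal (by positivity),
    ← LpNorm_eq hp (Delta_meas _ _ hf.2.1), ← LpNorm_eq hp hfg.2.1, ← LpNorm_eq hp hdm.2.1] at h2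
  refine h2.trans ?_
  have h3 := LpNorm_nonneg p (iteratedDeriv (k+1) g)
  have h4 : h ^ (k+1) ≤ 1 / (n:ℝ) ^ (k+1) := by
    rw [← one_div_pow]
    gcongr
  rw [← mul_assoc]
  gcongr

lemma exists_approx (hp : 1 ≤ p) (hn : 1 ≤ n) (hf : MemLpT p f) : ∃ g, SobolevW (k+1) g ∧
    LpNorm p (fun t => f t - g t) ≤ omegaMod (k+1) p f (1 / (n:ℝ)) ∧
    (1 / (n:ℝ) ^ (k+1)) * LpNorm p (iteratedDeriv (k+1) g) ≤
      2 ^ (k+1) * ((k:ℝ) + 3) ^ (k+1) * omegaMod (k+1) p f (1 / (n:ℝ)) := by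
  have hn0 : (0:ℝ) < n := by exact_mod_cast hn
  have hω := omega_nonneg p (k+1) f (1 / (n:ℝ))
  set ω := omegaMod (k+1) p f (1 / (n:ℝ)) with hωd
  have hG := good_of_memLpT hp hf
  have hB : ∀ v, 0 < v → v < 1 / (n:ℝ) → EN p (Delta (k+1) v f) ≤ ENNReal.ofReal ω :=
    fun v h1 h2 => EN_Delta_le_omega hp hf (k+1) h1 h2
  set h : ℝ := 1 / (((k:ℝ)+3) * n) with hh
  have hpos : 0 < h := by positivity
  have hlt : ((k:ℝ) + 2) * h < 1 / (n:ℝ) := by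
    rw [hh]
    rw [mul_one_div, div_lt_div_iff₀ (by positivity) hn0]
    nlinarith
  have hsm := gApp_smooth (s := k+1) hpos hG
  have hgm := sobolev_memLpT hp hsm.1
  have hdm := sobolev_deriv_memLpT hp hsm.1
  refine ⟨gApp (k+1) h f, hsm.1, ?_, ?_⟩
  · have h1 := EN_f_sub_gApp hp (s := k+1) (by omega) hpos hG hB
      (by push_cast; linarith)
    rw [LpNorm_eq hp (memLpT_sub hp hf hgm).2.1]
    exact ENNReal.toReal_le_of_le_ofReal hω h1
  · have h1 := EN_gApp_deriv hp (s := k+1) hpos hG hB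
      (by push_cast; linarith)
    rw [← ENNReal.ofReal_mul (by positivity)] at h1
    have h2 := ENNReal.toReal_le_of_le_ofReal (by positivity) h1
    rw [← LpNorm_eq hp hdm.2.1] at h2
    calc _ ≤ (1 / (n:ℝ) ^ (k+1)) * (2 ^ (k+1) * (h⁻¹) ^ (k+1) * ω) := by gcongr
      _ = _ := by
        rw [hh, one_div (((k:ℝ)+3) * n), inv_inv, mul_pow]
        field_simp

end main

theorem stmt11 (p γ : ℝ) (r s : ℕ) (X : ℕ → ℕ → ℝ)
    (hp : 1 ≤ p) (hr : 1 ≤ r) (hs : 1 ≤ s) (hsr : s ≤ 2 * r)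
    (hγ0 : 0 < γ) (hγ1 : γ ≤ 1) (hX : NodesOK γ X) :
    ∃ c C : ℝ, 0 < c ∧ 0 < C ∧ ∀ f : ℝ → ℝ, MemLpT p f → ∀ n : ℕ, 1 ≤ n →
      c * (ellp p n (X n) (fun x => steklov r (γ / (n : ℝ)) f x - f x) + omegaMod s p f (1 / (n : ℝ))) ≤ Kfun s p n (X n) f ∧
        Kfun s p n (X n) f ≤ C * (ellp p n (X n) (fun x => steklov r (γ / (n : ℝ)) f x - f x) + omegaMod s p f (1 / (n : ℝ))) := by
  obtain ⟨k, rfl⟩ : ∃ k, s = k + 1 := ⟨s - 1, by omega⟩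
  set C1 : ℝ := (2 * (∑ ν ∈ Finset.range r, ((2*r).choose ν : ℝ)) * r) * γ⁻¹ with hC1
  set C2 : ℝ := 4 ^ r * γ⁻¹ with hC2
  set Q : ℝ := 2 ^ (k+1) * ((k:ℝ) + 3) ^ (k+1) with hQ
  have hC1n : 0 ≤ C1 := by positivity
  have hC2n : 0 ≤ C2 := by positivity
  have hQn : 0 ≤ Q := by positivity
  have hMpos : 0 < 1 + C1 + C2 + 2 ^ (k+1) + ((k:ℝ)+1) := by positivity
  refine ⟨(1 + C1 + C2 + 2 ^ (k+1) + ((k:ℝ)+1))⁻¹, 1 + (1 + C1) + (1 + C2) * Q,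
    by positivity, by positivity, ?_⟩
  intro f hf n hn
  constructor
  · apply le_csInf
    · exact ⟨_, fun _ => 0, ⟨fun x => rfl, contDiff_const⟩, rfl⟩
    · rintro y ⟨g, hg, rfl⟩
      have h1 := ellp_lower hp hγ0 hγ1 hX hn hr hsr hf hg
      have h2 := omega_lower hp hn hf hg
      rw [inv_mul_le_iff₀ hMpos]
      have e0 := ellp_nonneg p n (X n) (fun t => f t - g t)
      have a0 := LpNorm_nonneg p (fun t => f t - g t)
      have d0 : 0 ≤ (1 / (n:ℝ) ^ (k+1)) * LpNorm p (iteratedDeriv (k+1) g) :=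
        mul_nonneg (by positivity) (LpNorm_nonneg _ _)
      have q0 : (0:ℝ) ≤ 2 ^ (k+1) := by positivity
      have k0 : (0:ℝ) ≤ (k:ℝ) + 1 := by positivity
      have := mul_nonneg hC1n e0
      have := mul_nonneg hC1n d0
      have := mul_nonneg hC2n e0
      have := mul_nonneg hC2n a0
      have := mul_nonneg q0 e0
      have := mul_nonneg q0 d0
      have := mul_nonneg k0 e0
      have := mul_nonneg k0 a0
      nlinarith
  · obtain ⟨g, hg, ha, hd⟩ := exists_approx hp (k := k) hn hf
    have he := ellp_upper hp hγ0 hγ1 hX hn hr hsr hf hg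
    have hω := omega_nonneg p (k+1) f (1 / (n:ℝ))
    have hl := ellp_nonneg p n (X n) (fun x => steklov r (γ / (n : ℝ)) f x - f x)
    have hK : Kfun (k+1) p n (X n) f ≤ ellp p n (X n) (fun t => f t - g t) +
        LpNorm p (fun t => f t - g t) +
        (1 / (n : ℝ) ^ (k+1)) * LpNorm p (iteratedDeriv (k+1) g) := by
      apply csInf_le
      · refine ⟨0, ?_⟩
        rintro y ⟨g', -, rfl⟩
        have := ellp_nonneg p n (X n) (fun t => f t - g' t)
        have := LpNorm_nonneg p (fun t => f t - g' t)
        have : 0 ≤ (1 / (n:ℝ) ^ (k+1)) * LpNorm p (iteratedDeriv (k+1) g') :=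
          mul_nonneg (by positivity) (LpNorm_nonneg _ _)
        linarith
      · exact ⟨g, hg, rfl⟩
    refine hK.trans ?_
    have := mul_le_mul_of_nonneg_left ha hC1n
    have := mul_le_mul_of_nonneg_left hd hC2n
    have := mul_nonneg hC1n hl
    have := mul_nonneg (mul_nonneg hC2n hQn) hl
    have := mul_nonneg hQn hl
    nlinarith
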